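/- arXiv:2212.06280 — 7 statements merged into one kernel-verified Lean document; each statement's English description precedes it below -/
import Mathlib

section
/- Let F be a field. Every injective F-algebra homomorphism ι : F × F → Mat₂(F) is conjugate to the diagonal embedding: there exists g ∈ GL₂(F) such that g · ι(a, d) · g⁻¹ = diag(a, d) for all (a, d) ∈ F × F. -/
open Matrix in
/-- A nonzero idempotent matrix fixes some nonzero vector. -/
theorem Matrix.exists_ne_zero_mulVec_eq_self_of_isIdempotentElem
    {n R : Type*} [Fintype n] [CommRing R] {P : Matrix n n R}
    (hP : IsIdempotentElem P) (h0 : P ≠ 0) : ∃ v : n → R, v ≠ 0 ∧ P *ᵥ v = v := by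
  classical
  obtain ⟨x, hx⟩ : ∃ x : n → R, P *ᵥ x ≠ 0 := by
    by_contra! h
    exact h0 (Matrix.ext_of_mulVec_single fun i => by rw [h, Matrix.zero_mulVec])
  exact ⟨P *ᵥ x, hx, by rw [Matrix.mulVec_mulVec, hP.eq]⟩

/-- Every injective `F`-algebra homomorphism `F × F → Mat₂(F)`
is conjugate to the diagonal embedding. -/
theorem split_embedding_conjugate_to_diagonal
    (F : Type*) [Field F]
    (ι : (F × F) →ₐ[F] Matrix (Fin 2) (Fin 2) F)
    (hι : Function.Injective ι) :
    ∃ g : (Matrix (Fin 2) (Fin 2) F)ˣ,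
      ∀ a d : F, (g : Matrix (Fin 2) (Fin 2) F) * ι (a, d) * (↑g⁻¹ : Matrix (Fin 2) (Fin 2) F)
        = Matrix.diagonal ![a, d] := by
  open Matrix in
  have exists_fixed (e : F × F) (he : e * e = e) (h0 : e ≠ 0) :
      ∃ v : Fin 2 → F, v ≠ 0 ∧ ι e *ᵥ v = v :=
    Matrix.exists_ne_zero_mulVec_eq_self_of_isIdempotentElem
      (by rw [IsIdempotentElem, ← map_mul, he]) ((map_ne_zero_iff ι hι).mpr h0)
  obtain ⟨v, hv0, hv⟩ := exists_fixed (1, 0) (by simp) (by simp)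
  obtain ⟨w, hw0, hw⟩ := exists_fixed (0, 1) (by simp) (by simp)
  have hv_act (a d : F) : ι (a, d) *ᵥ v = a • v := by
    have h : ((a, d) : F × F) * (1, 0) = a • (1, 0) := by simp
    rw [← hv, Matrix.mulVec_mulVec, ← map_mul, h, map_smul, Matrix.smul_mulVec, hv]
  have hw_act (a d : F) : ι (a, d) *ᵥ w = d • w := by
    have h : ((a, d) : F × F) * (0, 1) = d • (0, 1) := by simp
    rw [← hw, Matrix.mulVec_mulVec, ← map_mul, h, map_smul, Matrix.smul_mulVec, hw]
  have hli : LinearIndependent F ![v, w] := by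
    refine LinearIndependent.pair_iff.mpr fun s t hst => ?_
    have hs := congrArg (ι (1, 0) *ᵥ ·) hst
    have ht := congrArg (ι (0, 1) *ᵥ ·) hst
    simp only [Matrix.mulVec_add, Matrix.mulVec_smul, hv_act, hw_act, Matrix.mulVec_zero] at hs ht
    simp_all
  obtain ⟨h, hh⟩ : IsUnit (Matrix.of ![v, w])ᵀ :=
    Matrix.linearIndependent_cols_iff_isUnit.mp hli
  refine ⟨h⁻¹, fun a d => ?_⟩
  have key : ι (a, d) * (h : Matrix (Fin 2) (Fin 2) F) = h * Matrix.diagonal ![a, d] := by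
    ext i j
    have h1 := congrFun (hv_act a d) i
    have h2 := congrFun (hw_act a d) i
    rw [hh, Matrix.mul_diagonal]
    fin_cases j
    · simpa [Matrix.mul_apply, Matrix.mulVec, dotProduct, mul_comm] using h1
    · simpa [Matrix.mul_apply, Matrix.mulVec, dotProduct, mul_comm] using h2
  rw [inv_inv, mul_assoc, key, Units.inv_mul_cancel_left]
end

section
/- Let G∞, G_f be groups, G = G∞ × G_f with first projection π∞, Γ ≤ G a subgroup, K∞ ≤ G∞ and U_f ≤ G_f subgroups, and U = K∞ × U_f. Let T = T∞ × T_f ≤ G be a subgroup with T∞ ≤ G∞ and T_f ≤ G_f, and let g = (g∞, g_f) ∈ G satisfy T∞ = g∞ K∞ g∞⁻¹. Assume that every γ ∈ Γ with π∞(γ) ∈ T∞ lies in T. Then the assignment t ↦ Γ t g U induces a well-defined bijection from the double coset space (Γ ∩ T)\T/(T ∩ gUg⁻¹) onto the packet [Tg]_U := {Γ t g U : t ∈ T} ⊆ Γ\G/U. -/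
/-- The double coset `H x K` of `x` with respect to two subsets `H, K` of a group. -/
def doubleCoset {G : Type*} [Group G] (H K : Set G) (x : G) : Set G :=
  {y | ∃ h ∈ H, ∃ k ∈ K, y = h * x * k}

theorem doubleCoset_eq_iff {G : Type*} [Group G] (H K : Subgroup G) (x y : G) :
    doubleCoset (H : Set G) (K : Set G) x = doubleCoset (H : Set G) (K : Set G) y ↔
      ∃ h ∈ H, ∃ k ∈ K, y = h * x * k := by
  constructor
  · intro hxy
    have hy : y ∈ doubleCoset (H : Set G) (K : Set G) y :=
      ⟨1, H.one_mem, 1, K.one_mem, by simp⟩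
    rwa [← hxy] at hy
  · rintro ⟨h, hh, k, hk, rfl⟩
    ext z
    constructor
    · rintro ⟨a, ha, b, hb, rfl⟩
      exact ⟨a * h⁻¹, H.mul_mem ha (H.inv_mem hh), k⁻¹ * b, K.mul_mem (K.inv_mem hk) hb,
        by group⟩
    · rintro ⟨a, ha, b, hb, rfl⟩
      exact ⟨a * h, H.mul_mem ha hh, k * b, K.mul_mem hk hb, by group⟩

/-- If every `γ ∈ Γ` carrying a point of `Tg` into `TgU` lies in `T`, then two elements of `T`
have the same image in `Γ\G/U` exactly when they agree in `(Γ ∩ T)\T/(T ∩ gUg⁻¹)`. -/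
theorem doubleCoset_inter_eq_iff {G : Type*} [Group G] (Γ T U : Subgroup G) (g : G)
    (hΓ : ∀ γ ∈ Γ, ∀ s ∈ T, ∀ t ∈ T, ∀ u ∈ U, t * g = γ * (s * g) * u → γ ∈ T)
    {s t : G} (hs : s ∈ T) (ht : t ∈ T) :
    doubleCoset ((Γ : Set G) ∩ T) ((T : Set G) ∩ ((fun u => g * u * g⁻¹) '' (U : Set G))) s =
        doubleCoset ((Γ : Set G) ∩ T) ((T : Set G) ∩ ((fun u => g * u * g⁻¹) '' (U : Set G))) t ↔
      doubleCoset (Γ : Set G) (U : Set G) (s * g) =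
        doubleCoset (Γ : Set G) (U : Set G) (t * g) := by
  have hcoe : (T : Set G) ∩ ((fun u => g * u * g⁻¹) '' (U : Set G)) =
      ((T ⊓ U.map (MulAut.conj g).toMonoidHom : Subgroup G) : Set G) := rfl
  rw [hcoe, ← Subgroup.coe_inf, doubleCoset_eq_iff, doubleCoset_eq_iff]
  constructor
  · rintro ⟨γ, hγ, _, ⟨_, u, hu, rfl⟩, rfl⟩
    exact ⟨γ, hγ.1, u, hu, by simp [mul_assoc]⟩
  · rintro ⟨γ, hγ, u, hu, h⟩
    have hγT := hΓ γ hγ s hs t ht u hu h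
    have hconj : g * u * g⁻¹ = s⁻¹ * γ⁻¹ * t := by
      rw [eq_mul_inv_of_mul_eq h]
      group
    refine ⟨γ, ⟨hγ, hγT⟩, g * u * g⁻¹, ⟨?_, u, hu, rfl⟩, ?_⟩
    · rw [hconj]
      exact T.mul_mem (T.mul_mem (T.inv_mem hs) (T.inv_mem hγT)) ht
    · rw [hconj]
      group

theorem exists_equiv_of_eq_iff_eq {ι α β : Type*} {p : ι → Prop} (f : ι → α) (f' : ι → β)
    (h : ∀ s t, p s → p t → (f s = f t ↔ f' s = f' t)) :
    ∃ e : {a // ∃ t, p t ∧ a = f t} ≃ {b // ∃ t, p t ∧ b = f' t},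
      ∀ t (ht : p t), (e ⟨f t, t, ht, rfl⟩ : β) = f' t := by
  choose r hrp hr using fun a : {a // ∃ t, p t ∧ a = f t} => a.2
  let F : {a // ∃ t, p t ∧ a = f t} → {b // ∃ t, p t ∧ b = f' t} :=
    fun a => ⟨f' (r a), r a, hrp a, rfl⟩
  have hF : ∀ t (ht : p t), (F ⟨f t, t, ht, rfl⟩ : β) = f' t := fun t ht =>
    (h _ _ (hrp _) ht).1 (hr ⟨f t, t, ht, rfl⟩).symm
  refine ⟨Equiv.ofBijective F ⟨?_, ?_⟩, hF⟩
  · rintro ⟨_, s, hs, rfl⟩ ⟨_, t, ht, rfl⟩ hst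
    have hst' := congrArg Subtype.val hst
    rw [hF s hs, hF t ht] at hst'
    exact Subtype.ext ((h s t hs ht).2 hst')
  · rintro ⟨_, t, ht, rfl⟩
    exact ⟨⟨f t, t, ht, rfl⟩, Subtype.ext (hF t ht)⟩

/-- With `G = G∞ × G_f`, `Γ ≤ G`, `U = K∞ × U_f`,
`T = T∞ × T_f`, `g = (g∞, g_f)` with `T∞ = g∞ K∞ g∞⁻¹`, and assuming every
`γ ∈ Γ` whose archimedean component lies in `T∞` lies in `T`, the map
`t ↦ Γ t g U` induces a bijection from `(Γ ∩ T)\T/(T ∩ gUg⁻¹)` onto the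
Heegner packet `[Tg]_U = {Γ t g U : t ∈ T} ⊆ Γ\G/U`. -/
theorem heegner_packet_bijection
    {Ginf Gf : Type*} [Group Ginf] [Group Gf]
    (Γ : Subgroup (Ginf × Gf)) (Kinf : Subgroup Ginf) (Uf : Subgroup Gf)
    (Tinf : Subgroup Ginf) (Tf : Subgroup Gf)
    (ginf : Ginf) (gf : Gf)
    (hconj : (Tinf : Set Ginf) = (fun k => ginf * k * ginf⁻¹) '' (Kinf : Set Ginf))
    (hrat : ∀ γ ∈ Γ, γ.1 ∈ Tinf → γ ∈ Tinf.prod Tf) :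
    ∃ e : {S : Set (Ginf × Gf) // ∃ t ∈ Tinf.prod Tf,
            S = doubleCoset ((Γ : Set (Ginf × Gf)) ∩ (Tinf.prod Tf : Set (Ginf × Gf)))
                  ((Tinf.prod Tf : Set (Ginf × Gf)) ∩
                    ((fun u => (ginf, gf) * u * (ginf, gf)⁻¹) ''
                      ((Kinf.prod Uf : Subgroup (Ginf × Gf)) : Set (Ginf × Gf)))) t} ≃
         {S : Set (Ginf × Gf) // ∃ t ∈ Tinf.prod Tf,
            S = doubleCoset (Γ : Set (Ginf × Gf))
                  ((Kinf.prod Uf : Subgroup (Ginf × Gf)) : Set (Ginf × Gf)) (t * (ginf, gf))},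
      ∀ t (ht : t ∈ Tinf.prod Tf),
        (e ⟨doubleCoset ((Γ : Set (Ginf × Gf)) ∩ (Tinf.prod Tf : Set (Ginf × Gf)))
              ((Tinf.prod Tf : Set (Ginf × Gf)) ∩
                ((fun u => (ginf, gf) * u * (ginf, gf)⁻¹) ''
                  ((Kinf.prod Uf : Subgroup (Ginf × Gf)) : Set (Ginf × Gf)))) t,
            ⟨t, ht, rfl⟩⟩ : Set (Ginf × Gf))
          = doubleCoset (Γ : Set (Ginf × Gf))
              ((Kinf.prod Uf : Subgroup (Ginf × Gf)) : Set (Ginf × Gf)) (t * (ginf, gf)) := by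
  refine exists_equiv_of_eq_iff_eq _ _ fun s t hs ht =>
    doubleCoset_inter_eq_iff Γ (Tinf.prod Tf) (Kinf.prod Uf) (ginf, gf) ?_ hs ht
  intro γ hγ s hs t ht u hu h
  refine hrat γ hγ ?_
  have hu' : ginf * u.1⁻¹ * ginf⁻¹ ∈ Tinf := by
    rw [← SetLike.mem_coe, hconj]
    exact ⟨u.1⁻¹, Kinf.inv_mem hu.1, rfl⟩
  have hγ₁ : γ.1 = t.1 * (ginf * u.1⁻¹ * ginf⁻¹) * s.1⁻¹ := by
    have h₁ : t.1 * ginf = γ.1 * (s.1 * ginf) * u.1 := congrArg Prod.fst h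
    rw [eq_mul_inv_of_mul_eq h₁]
    group
  rw [hγ₁]
  exact Tinf.mul_mem (Tinf.mul_mem ht.1 hu') (Tinf.inv_mem hs.1)
end

section
/- Let G∞, G_f be groups, G = G∞ × G_f with first projection π∞, Γ ≤ G a subgroup, K∞ ≤ G∞ and U_f ≤ G_f subgroups, and U = K∞ × U_f. For i = 1, 2, let Tᵢ = Tᵢ∞ × Tᵢf ≤ G with Tᵢ∞ ≤ G∞, Tᵢf ≤ G_f, and gᵢ = (gᵢ∞, gᵢf) ∈ G with Tᵢ∞ = gᵢ∞ K∞ gᵢ∞⁻¹. Assume: (i) for i = 1, 2, every γ ∈ Γ with π∞(γ) ∈ Tᵢ∞ lies in Tᵢ; (ii) every γ ∈ Γ satisfying π∞(γ) T₁∞ π∞(γ)⁻¹ = T₂∞ and γ (Γ∩T₁) γ⁻¹ = Γ∩T₂ satisfies γ T₁ γ⁻¹ = T₂. If the packets [T₁g₁]_U = {Γ t g₁ U : t ∈ T₁} and [T₂g₂]_U = {Γ t g₂ U : t ∈ T₂} have a common element, then there exists γ ∈ Γ with T₂ = γ T₁ γ⁻¹ and g₂ ∈ T₂ γ g₁ U;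 in particular [T₁g₁]_U = [T₂g₂]_U. -/
/-- The Heegner packet `[Tg]_U = {Γ t g U : t ∈ T}` as a set of subsets of `G`. -/
def heegnerPacket {G : Type*} [Group G] (Γ U T : Set G) (g : G) : Set (Set G) :=
  {S | ∃ t ∈ T, S = doubleCoset Γ U (t * g)}

/-- A double coset with respect to subgroups does not change when its representative is multiplied
by elements of these subgroups. -/
theorem doubleCoset_mul_mul {G : Type*} [Group G] (H K : Subgroup G) {h k : G}
    (hh : h ∈ H) (hk : k ∈ K) (x : G) :
    doubleCoset (H : Set G) (K : Set G) (h * x * k) = doubleCoset (H : Set G) (K : Set G) x := by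
  ext y
  constructor
  · rintro ⟨a, ha, b, hb, rfl⟩
    exact ⟨a * h, H.mul_mem ha hh, k * b, K.mul_mem hk hb, by group⟩
  · rintro ⟨a, ha, b, hb, rfl⟩
    exact ⟨a * h⁻¹, H.mul_mem ha (H.inv_mem hh), k⁻¹ * b, K.mul_mem (K.inv_mem hk) hb, by group⟩

/-- Conjugating a torus by `γ ∈ Γ` and moving the base point `g` accordingly does not change the
packet. -/
theorem heegnerPacket_eq_of_conj {G : Type*} [Group G] (Γ U T T' : Subgroup G) {γ s u : G}
    (hγ : γ ∈ Γ) (hT : (fun x => γ * x * γ⁻¹) '' (T : Set G) = (T' : Set G))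
    (hs : s ∈ T') (hu : u ∈ U) (g : G) :
    heegnerPacket (Γ : Set G) (U : Set G) (T : Set G) g =
      heegnerPacket (Γ : Set G) (U : Set G) (T' : Set G) (s * (γ * g) * u) := by
  ext S
  constructor
  · rintro ⟨t, ht, rfl⟩
    have ht' : γ * t * γ⁻¹ ∈ T' := hT.subset ⟨t, ht, rfl⟩
    refine ⟨γ * t * γ⁻¹ * s⁻¹, T'.mul_mem ht' (T'.inv_mem hs), ?_⟩
    rw [← doubleCoset_mul_mul Γ U hγ hu (t * g)]
    congr 1
    group
  · rintro ⟨t, ht, rfl⟩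
    obtain ⟨r, hr, hrt⟩ := hT.superset (T'.mul_mem ht hs)
    refine ⟨r, hr, ?_⟩
    rw [← doubleCoset_mul_mul Γ U hγ hu (r * g)]
    congr 1
    calc t * (s * (γ * g) * u) = t * s * (γ * g) * u := by group
      _ = γ * r * γ⁻¹ * (γ * g) * u := by rw [← hrt]
      _ = γ * (r * g) * u := by group

/-- If `T₁` and `T₂` are the conjugates of `K` by `g₁` and `g₂`, and `t₂ g₂ = c t₁ g₁ k`, then `c`
conjugates `T₁` to `T₂`. -/
theorem conj_image_eq_of_mul_eq {G : Type*} [Group G] {K T₁ T₂ : Subgroup G}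
    {g₁ g₂ t₁ t₂ c k : G}
    (h₁ : (T₁ : Set G) = (fun k => g₁ * k * g₁⁻¹) '' (K : Set G))
    (h₂ : (T₂ : Set G) = (fun k => g₂ * k * g₂⁻¹) '' (K : Set G))
    (ht₁ : t₁ ∈ T₁) (ht₂ : t₂ ∈ T₂) (hk : k ∈ K) (h : t₂ * g₂ = c * (t₁ * g₁) * k) :
    (fun x => c * x * c⁻¹) '' (T₁ : Set G) = (T₂ : Set G) := by
  have mem₁ (x : G) : x ∈ T₁ ↔ g₁⁻¹ * x * g₁ ∈ K := by
    rw [← SetLike.mem_coe, h₁]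
    exact ⟨by rintro ⟨a, ha, rfl⟩; simpa [mul_assoc] using ha, fun hx => ⟨_, hx, by group⟩⟩
  have mem₂ (x : G) : x ∈ T₂ ↔ g₂⁻¹ * x * g₂ ∈ K := by
    rw [← SetLike.mem_coe, h₂]
    exact ⟨by rintro ⟨a, ha, rfl⟩; simpa [mul_assoc] using ha, fun hx => ⟨_, hx, by group⟩⟩
  have hc : c = t₂ * g₂ * k⁻¹ * g₁⁻¹ * t₁⁻¹ := by rw [h]; group
  have key (x : G) : c * x * c⁻¹ ∈ T₂ ↔ x ∈ T₁ := by
    have e : c * x * c⁻¹ =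
        t₂ * (g₂ * (k⁻¹ * (g₁⁻¹ * (t₁⁻¹ * x * t₁) * g₁) * k) * g₂⁻¹) * t₂⁻¹ := by
      rw [hc]; group
    rw [e, T₂.mul_mem_cancel_right (T₂.inv_mem ht₂), T₂.mul_mem_cancel_left ht₂, mem₂]
    have e' (a : G) : g₂⁻¹ * (g₂ * a * g₂⁻¹) * g₂ = a := by group
    rw [e', K.mul_mem_cancel_right hk, K.mul_mem_cancel_left (K.inv_mem hk), ← mem₁,
      T₁.mul_mem_cancel_right ht₁, T₁.mul_mem_cancel_left (T₁.inv_mem ht₁)]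
  ext y
  constructor
  · rintro ⟨x, hx, rfl⟩
    exact (key x).2 hx
  · intro hy
    have e : c * (c⁻¹ * y * c) * c⁻¹ = y := by group
    exact ⟨c⁻¹ * y * c, (key _).1 (e.symm ▸ hy), e⟩

/-- Two Heegner packets that share a common double coset coincide,
and the underlying toral data are `Γ`-conjugate. -/
theorem heegner_packets_intersect_eq
    {Ginf Gf : Type*} [Group Ginf] [Group Gf]
    (Γ : Subgroup (Ginf × Gf)) (Kinf : Subgroup Ginf) (Uf : Subgroup Gf)
    (T1inf T2inf : Subgroup Ginf) (T1f T2f : Subgroup Gf)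
    (g1inf g2inf : Ginf) (g1f g2f : Gf)
    (hconj1 : (T1inf : Set Ginf) = (fun k => g1inf * k * g1inf⁻¹) '' (Kinf : Set Ginf))
    (hconj2 : (T2inf : Set Ginf) = (fun k => g2inf * k * g2inf⁻¹) '' (Kinf : Set Ginf))
    (hrat1 : ∀ γ ∈ Γ, γ.1 ∈ T1inf → γ ∈ T1inf.prod T1f)
    (hrat2 : ∀ γ ∈ Γ, γ.1 ∈ T2inf → γ ∈ T2inf.prod T2f)
    (hdense : ∀ γ ∈ Γ,
      (fun x => γ.1 * x * γ.1⁻¹) '' (T1inf : Set Ginf) = (T2inf : Set Ginf) →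
      (fun x => γ * x * γ⁻¹) '' ((Γ : Set (Ginf × Gf)) ∩ (T1inf.prod T1f : Set (Ginf × Gf)))
        = (Γ : Set (Ginf × Gf)) ∩ (T2inf.prod T2f : Set (Ginf × Gf)) →
      (fun x => γ * x * γ⁻¹) '' (T1inf.prod T1f : Set (Ginf × Gf))
        = (T2inf.prod T2f : Set (Ginf × Gf)))
    (hmeet : ∃ S : Set (Ginf × Gf),
      S ∈ heegnerPacket (Γ : Set (Ginf × Gf))
            ((Kinf.prod Uf : Subgroup (Ginf × Gf)) : Set (Ginf × Gf))
            (T1inf.prod T1f : Set (Ginf × Gf)) (g1inf, g1f) ∧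
      S ∈ heegnerPacket (Γ : Set (Ginf × Gf))
            ((Kinf.prod Uf : Subgroup (Ginf × Gf)) : Set (Ginf × Gf))
            (T2inf.prod T2f : Set (Ginf × Gf)) (g2inf, g2f)) :
    ∃ γ ∈ Γ,
      (fun x => γ * x * γ⁻¹) '' (T1inf.prod T1f : Set (Ginf × Gf))
          = (T2inf.prod T2f : Set (Ginf × Gf)) ∧
      (g2inf, g2f) ∈ doubleCoset (T2inf.prod T2f : Set (Ginf × Gf))
          ((Kinf.prod Uf : Subgroup (Ginf × Gf)) : Set (Ginf × Gf)) (γ * (g1inf, g1f)) ∧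
      heegnerPacket (Γ : Set (Ginf × Gf))
          ((Kinf.prod Uf : Subgroup (Ginf × Gf)) : Set (Ginf × Gf))
          (T1inf.prod T1f : Set (Ginf × Gf)) (g1inf, g1f)
        = heegnerPacket (Γ : Set (Ginf × Gf))
            ((Kinf.prod Uf : Subgroup (Ginf × Gf)) : Set (Ginf × Gf))
            (T2inf.prod T2f : Set (Ginf × Gf)) (g2inf, g2f) := by
  obtain ⟨S, ⟨t₁, ht₁, rfl⟩, ⟨t₂, ht₂, hS⟩⟩ := hmeet
  have hmem : t₂ * (g2inf, g2f) ∈ doubleCoset (Γ : Set (Ginf × Gf))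
      ((Kinf.prod Uf : Subgroup (Ginf × Gf)) : Set (Ginf × Gf)) (t₁ * (g1inf, g1f)) :=
    hS ▸ ⟨1, Γ.one_mem, 1, (Kinf.prod Uf).one_mem, by simp⟩
  obtain ⟨γ, hγ, u, hu, h⟩ := hmem
  have hinf : (fun x => γ.1 * x * γ.1⁻¹) '' (T1inf : Set Ginf) = (T2inf : Set Ginf) :=
    conj_image_eq_of_mul_eq hconj1 hconj2 ht₁.1 ht₂.1 hu.1 (congrArg Prod.fst h)
  have hT : (fun x => γ * x * γ⁻¹) '' (T1inf.prod T1f : Set (Ginf × Gf))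
      = (T2inf.prod T2f : Set (Ginf × Gf)) := by
    refine hdense γ hγ hinf (Set.Subset.antisymm ?_ ?_)
    · rintro _ ⟨x, ⟨hxΓ, hxT⟩, rfl⟩
      have hx : γ * x * γ⁻¹ ∈ Γ := Γ.mul_mem (Γ.mul_mem hγ hxΓ) (Γ.inv_mem hγ)
      exact ⟨hx, hrat2 _ hx (hinf.subset ⟨x.1, hxT.1, rfl⟩)⟩
    · rintro y ⟨hyΓ, hyT⟩
      have hy : γ⁻¹ * y * γ ∈ Γ := Γ.mul_mem (Γ.mul_mem (Γ.inv_mem hγ) hyΓ) hγ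
      obtain ⟨x, hx, hxy⟩ := hinf.superset hyT.1
      have hx' : (γ⁻¹ * y * γ).1 = x := by
        change γ.1⁻¹ * y.1 * γ.1 = x
        rw [← hxy]
        group
      exact ⟨γ⁻¹ * y * γ, ⟨hy, hrat1 _ hy (hx' ▸ hx)⟩, by group⟩
  have hs : t₂⁻¹ * (γ * t₁ * γ⁻¹) ∈ T2inf.prod T2f :=
    (T2inf.prod T2f).mul_mem ((T2inf.prod T2f).inv_mem ht₂) (hT.subset ⟨t₁, ht₁, rfl⟩)
  have hg : (g2inf, g2f) = t₂⁻¹ * (γ * t₁ * γ⁻¹) * (γ * (g1inf, g1f)) * u := by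
    rw [eq_inv_mul_of_mul_eq h]
    group
  refine ⟨γ, hγ, hT, ⟨_, hs, u, hu, hg⟩, ?_⟩
  rw [hg]
  exact heegnerPacket_eq_of_conj Γ (Kinf.prod Uf) (T1inf.prod T1f) (T2inf.prod T2f) hγ hT hs hu _
end

section
/- Let G∞, G_f be groups, G = G∞ × G_f, Γ ≤ G a subgroup, K∞ ≤ G∞ and U_f ≤ G_f subgroups, and U = K∞ × U_f. Let h = (1, h_f) ∈ {1} × G_f, U(h) = U ∩ hUh⁻¹, and define β_U : Γ\G/U(h) → (Γ×Γ)\(G×G)/(U×U) by β_U(Γ g U(h)) = (Γ×Γ)(g, gh)(U×U). Let T ≤ G be an abelian subgroup, g ∈ G, and suppose there exist γ ∈ Γ ∩ T and u, u' ∈ U with γ = g u h u' h⁻¹ g⁻¹. Then for every t ∈ T one has β_U(Γ (t g) U(h)) = β_U(Γ (t g u) U(h)), i.e. (Γ×Γ)(tg, tgh)(U×U) = (Γ×Γ)(tgu, tguh)(U×U). -/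
/-- Multiplying a representative by `a ∈ H` on the left and `b ∈ K` on the right does not change
its double coset. -/
theorem doubleCoset_mul_mul_of_mem {G : Type*} [Group G] {H K : Subgroup G} {a b : G}
    (ha : a ∈ H) (hb : b ∈ K) (x : G) :
    doubleCoset (H : Set G) (K : Set G) (a * x * b) = doubleCoset (H : Set G) (K : Set G) x := by
  ext y
  constructor
  · rintro ⟨c, hc, k, hk, rfl⟩
    exact ⟨c * a, H.mul_mem hc ha, b * k, K.mul_mem hb hk, by group⟩
  · rintro ⟨c, hc, k, hk, rfl⟩
    exact ⟨c * a⁻¹, H.mul_mem hc (H.inv_mem ha), b⁻¹ * k, K.mul_mem (K.inv_mem hb) hk, by group⟩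

/-- If an abelian subgroup `T` contains a rational element
`γ ∈ Γ ∩ T` of the shape `γ = g u h u' h⁻¹ g⁻¹` with `u, u' ∈ U`, then
`β_U(Γ (t g) U(h)) = β_U(Γ (t g u) U(h))` for every `t ∈ T`. -/
theorem hecke_graph_collision_on_packet
    {Ginf Gf : Type*} [Group Ginf] [Group Gf]
    (Γ : Subgroup (Ginf × Gf)) (Kinf : Subgroup Ginf) (Uf : Subgroup Gf)
    (T : Subgroup (Ginf × Gf))
    (habelian : ∀ a ∈ T, ∀ b ∈ T, a * b = b * a)
    (hf : Gf) (g : Ginf × Gf)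
    (γ : Ginf × Gf) (hγΓ : γ ∈ Γ) (hγT : γ ∈ T)
    (u : Ginf × Gf) (hu : u ∈ Kinf.prod Uf)
    (u' : Ginf × Gf) (hu' : u' ∈ Kinf.prod Uf)
    (hshape : γ = g * u * ((1 : Ginf), hf) * u' * ((1 : Ginf), hf)⁻¹ * g⁻¹) :
    ∀ t ∈ T,
      doubleCoset ((Γ.prod Γ : Subgroup ((Ginf × Gf) × (Ginf × Gf))) :
            Set ((Ginf × Gf) × (Ginf × Gf)))
          (((Kinf.prod Uf).prod (Kinf.prod Uf) : Subgroup ((Ginf × Gf) × (Ginf × Gf))) :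
            Set ((Ginf × Gf) × (Ginf × Gf)))
          (t * g, t * g * ((1 : Ginf), hf))
        = doubleCoset ((Γ.prod Γ : Subgroup ((Ginf × Gf) × (Ginf × Gf))) :
              Set ((Ginf × Gf) × (Ginf × Gf)))
            (((Kinf.prod Uf).prod (Kinf.prod Uf) : Subgroup ((Ginf × Gf) × (Ginf × Gf))) :
              Set ((Ginf × Gf) × (Ginf × Gf)))
            (t * g * u, t * g * u * ((1 : Ginf), hf)) := by
  intro t ht
  have hcomm : t * g * u * ((1 : Ginf), hf) = γ * (t * g * ((1 : Ginf), hf)) * u'⁻¹ := by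
    calc t * g * u * ((1 : Ginf), hf)
        = t * γ * (g * ((1 : Ginf), hf) * u'⁻¹) := by rw [hshape]; group
      _ = γ * (t * g * ((1 : Ginf), hf)) * u'⁻¹ := by
        rw [habelian t ht γ hγT]; simp only [mul_assoc]
  have hpair : (t * g * u, t * g * u * ((1 : Ginf), hf))
      = (1, γ) * (t * g, t * g * ((1 : Ginf), hf)) * (u, u'⁻¹) := by
    exact Prod.ext (by rw [Prod.fst_mul, Prod.fst_mul, one_mul]) hcomm
  rw [hpair]
  exact (doubleCoset_mul_mul_of_mem
    (Subgroup.mem_prod.mpr ⟨Γ.one_mem, hγΓ⟩)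
    (Subgroup.mem_prod.mpr ⟨hu, (Kinf.prod Uf).inv_mem hu'⟩) _).symm
end

section
/- Let E be a quadratic number field with ring of integers O_E, and let σ denote the nontrivial element of Gal(E/ℚ) (acting on O_E). Let 𝔞, 𝔟 ⊆ O_E be nonzero primitive integral ideals with equal absolute norms. Then there exist integral ideals 𝔤, 𝔠 of O_E such that 𝔞 = 𝔤·𝔠 and 𝔟 = 𝔤·σ(𝔠), where σ(𝔠) denotes the image of 𝔠 under the automorphism of O_E induced by σ. -/
open NumberField

/-- In a quadratic field, the norm of `x` is the product of `x` and its conjugate. -/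
theorem algebraMap_norm_eq_mul_of_finrank_eq_two {E : Type*} [Field E] [NumberField E]
    (hE : Module.finrank ℚ E = 2) (σ : E ≃ₐ[ℚ] E) (hσ : σ ≠ 1) (x : E) :
    algebraMap ℚ E (Algebra.norm ℚ x) = x * σ x := by
  classical
  have : Algebra.IsQuadraticExtension ℚ E := ⟨hE⟩
  have hcard : Fintype.card (E ≃ₐ[ℚ] E) = 2 := by
    rw [← Nat.card_eq_fintype_card, IsGalois.card_aut_eq_finrank, hE]
  have huniv : (Finset.univ : Finset (E ≃ₐ[ℚ] E)) = {1, σ} := by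
    symm
    rw [← Finset.card_eq_iff_eq_univ, hcard, Finset.card_pair hσ.symm]
  rw [Algebra.norm_eq_prod_automorphisms, huniv, Finset.prod_pair hσ.symm, AlgEquiv.one_apply]

/-- Nested nonzero ideals of a ring of integers with the same absolute norm are equal. -/
theorem Ideal.eq_of_le_of_absNorm_eq {E : Type*} [Field E] [NumberField E]
    {I J : Ideal (𝓞 E)} (hle : I ≤ J) (hI : I ≠ 0)
    (h : Ideal.absNorm I = Ideal.absNorm J) : I = J := by
  obtain ⟨K, rfl⟩ := Ideal.dvd_iff_le.mpr hle
  have hJ : Ideal.absNorm J ≠ 0 := by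
    rw [← h]; exact fun h0 => hI (Ideal.absNorm_eq_zero_iff.mp h0)
  have hK : Ideal.absNorm K = 1 := by
    rw [map_mul] at h
    exact (mul_eq_left₀ hJ).mp h
  rw [Ideal.absNorm_eq_one_iff.mp hK, Ideal.mul_top]

/-- An ideal of a ring of integers and its image under an automorphism have the same norm. -/
theorem Ideal.absNorm_map_mapRingHom {E : Type*} [Field E] [NumberField E]
    (σ : E ≃ₐ[ℚ] E) (I : Ideal (𝓞 E)) :
    Ideal.absNorm (I.map (RingOfIntegers.mapRingHom (σ : E →+* E))) = Ideal.absNorm I := by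
  have h := Ideal.relNorm_map_algEquiv
    (RingOfIntegers.mapRingEquiv (σ : E ≃+* E)).toIntAlgEquiv I
  have h' := congrArg Ideal.absNorm h
  rw [Ideal.absNorm_relNorm, Ideal.absNorm_relNorm] at h'
  exact h'

/-- In a quadratic field, the product of an ideal and its conjugate is generated by its norm. -/
theorem Ideal.mul_map_conj_eq_span_absNorm {E : Type*} [Field E] [NumberField E]
    (hE : Module.finrank ℚ E = 2) (σ : E ≃ₐ[ℚ] E) (hσ : σ ≠ 1) {I : Ideal (𝓞 E)} (hI : I ≠ 0) :
    I * I.map (RingOfIntegers.mapRingHom (σ : E →+* E)) =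
      Ideal.span {(Ideal.absNorm I : 𝓞 E)} := by
  have hspan : Ideal.span {(Ideal.absNorm I : 𝓞 E)} =
      (Ideal.relNorm ℤ I).map (algebraMap ℤ (𝓞 E)) := by
    rw [Ideal.relNorm_int, Ideal.map_span, Set.image_singleton]
    simp
  symm
  apply Ideal.eq_of_le_of_absNorm_eq
  · rw [hspan, Ideal.map_relNorm, Ideal.span_le]
    rintro _ ⟨x, hx, rfl⟩
    have hnorm : algebraMap ℤ (𝓞 E) (Algebra.intNorm ℤ (𝓞 E) x) =
        x * RingOfIntegers.mapRingHom (σ : E →+* E) x := by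
      apply RingOfIntegers.ext
      rw [Algebra.intNorm_eq_norm, RingOfIntegers.coe_eq_algebraMap,
        RingOfIntegers.coe_eq_algebraMap, map_mul, ← RingOfIntegers.coe_eq_algebraMap,
        ← RingOfIntegers.coe_eq_algebraMap, ← RingOfIntegers.coe_eq_algebraMap, RingOfIntegers.mapRingHom_apply]
      have := algebraMap_norm_eq_mul_of_finrank_eq_two hE σ hσ (x : E)
      rw [← Algebra.coe_norm_int] at this
      simpa using this
    simp only [Function.comp_apply, hnorm]
    exact Ideal.mul_mem_mul hx (Ideal.mem_map_of_mem _ hx)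
  · simpa [Ideal.absNorm_eq_zero_iff] using hI
  · rw [map_mul, Ideal.absNorm_map_mapRingHom, hspan, Ideal.absNorm_algebraMap,
      Ideal.absNorm_relNorm, RingOfIntegers.rank, hE, pow_two]

/-- In a quadratic number field, two primitive integral ideals with the
same absolute norm differ by the Galois conjugation on their coprime-to-gcd parts:
`𝔞 = 𝔤·𝔠` and `𝔟 = 𝔤·σ(𝔠)`. -/
theorem primitive_ideals_same_norm_decomposition
    (E : Type*) [Field E] [NumberField E]
    (hE : Module.finrank ℚ E = 2)
    (σ : E ≃ₐ[ℚ] E) (hσ : σ ≠ 1)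
    (a b : Ideal (𝓞 E)) (ha : a ≠ 0) (hb : b ≠ 0)
    (hprima : ¬∃ n : ℕ, 2 ≤ n ∧ a ≤ Ideal.span {(n : 𝓞 E)})
    (hprimb : ¬∃ n : ℕ, 2 ≤ n ∧ b ≤ Ideal.span {(n : 𝓞 E)})
    (hnorm : Ideal.absNorm a = Ideal.absNorm b) :
    ∃ g c : Ideal (𝓞 E),
      a = g * c ∧ b = g * Ideal.map (RingOfIntegers.mapRingHom σ) c := by
  obtain ⟨c, hc⟩ : a ⊔ b ∣ a := Ideal.dvd_iff_le.mpr le_sup_left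
  obtain ⟨d, hd⟩ : a ⊔ b ∣ b := Ideal.dvd_iff_le.mpr le_sup_right
  have hg : a ⊔ b ≠ 0 := fun h => ha (by rw [hc, h, zero_mul])
  have hc0 : c ≠ 0 := fun h => ha (by rw [hc, h, mul_zero])
  have hd0 : d ≠ 0 := fun h => hb (by rw [hd, h, mul_zero])
  have hcop : IsCoprime c d := by
    rw [Ideal.isCoprime_iff_sup_eq]
    apply mul_left_cancel₀ hg
    rw [Ideal.mul_sup, ← hc, ← hd, Ideal.mul_top]
  have hcd : Ideal.absNorm c = Ideal.absNorm d := by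
    apply mul_left_cancel₀ (fun h => hg (Ideal.absNorm_eq_zero_iff.mp h))
    rw [← map_mul, ← map_mul, ← hc, ← hd, hnorm]
  have hconj : d * d.map (RingOfIntegers.mapRingHom (σ : E →+* E)) =
      c * c.map (RingOfIntegers.mapRingHom (σ : E →+* E)) := by
    rw [Ideal.mul_map_conj_eq_span_absNorm hE σ hσ hd0,
      Ideal.mul_map_conj_eq_span_absNorm hE σ hσ hc0, hcd]
  have hdvd : d ∣ c.map (RingOfIntegers.mapRingHom (σ : E →+* E)) :=
    hcop.symm.dvd_of_dvd_mul_left (hconj ▸ dvd_mul_right _ _)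
  refine ⟨a ⊔ b, c, hc, hd.trans (congrArg _ ?_)⟩
  symm
  apply Ideal.eq_of_le_of_absNorm_eq (Ideal.dvd_iff_le.mp hdvd)
  · intro h
    have hzero := Ideal.absNorm_map_mapRingHom σ c
    rw [h, Ideal.zero_eq_bot, Ideal.absNorm_bot] at hzero
    exact hc0 (Ideal.absNorm_eq_zero_iff.mp hzero.symm)
  · exact (Ideal.absNorm_map_mapRingHom σ c).trans hcd
end

section
/- For every real number x with |x| ≤ 2 one has |x| ≤ 1 + (x² − 1)/2 − (x² − 1)²/18. -/
/-- For every real `x` with `|x| ≤ 2` one has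
`|x| ≤ 1 + (x² − 1)/2 − (x² − 1)²/18`. -/
theorem abs_le_hecke_ineq (x : ℝ) (hx : |x| ≤ 2) :
    |x| ≤ 1 + (x ^ 2 - 1) / 2 - (x ^ 2 - 1) ^ 2 / 18 := by
  rw [← sq_abs x]
  have h : 0 ≤ (|x| - 1) ^ 2 * ((2 - |x|) * (|x| + 4)) :=
    mul_nonneg (sq_nonneg _) (mul_nonneg (sub_nonneg.2 hx) (by positivity))
  linarith
end

section
/- Let p be a prime and let f, j, k be natural numbers with f ≤ j and j ≤ k − f. Let a, d ∈ ℤ_p^× be p-adic units, b ∈ ℤ_p, and c ∈ ℚ_p with |c|_p ≤ p^{−k}. Let x ∈ ℚ_p with |x|_p = p^{−j} and y ∈ ℤ_p^×. Then ad − bc ∈ ad·(1 + p^kℤ_p), and (ax + cy)(bx + dy) ∈ adxy·(1 + p^fℤ_p); that is, there exists z ∈ ℚ_p with |z|_p ≤ p^{−f} such that (ax + cy)(bx + dy) = adxy·(1 + z). -/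
/-- The key `p`-adic congruences: with `a, d ∈ ℤ_p^×`, `b ∈ ℤ_p`,
`c ∈ p^kℤ_p`, `x` of valuation `j` with `f ≤ j ≤ k − f`, and `y ∈ ℤ_p^×`, one has
`ad − bc ∈ ad(1 + p^kℤ_p)` and `(ax + cy)(bx + dy) ∈ adxy(1 + p^fℤ_p)`. -/
theorem padic_orientation_congruences
    (p : ℕ) [Fact p.Prime] (f j k : ℕ) (hfj : f ≤ j) (hjk : j + f ≤ k)
    (a d b c x y : ℚ_[p])
    (ha : ‖a‖ = 1) (hd : ‖d‖ = 1) (hb : ‖b‖ ≤ 1)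
    (hc : ‖c‖ ≤ (p : ℝ) ^ (-(k : ℤ)))
    (hx : ‖x‖ = (p : ℝ) ^ (-(j : ℤ)))
    (hy : ‖y‖ = 1) :
    (∃ z : ℚ_[p], ‖z‖ ≤ (p : ℝ) ^ (-(k : ℤ)) ∧ a * d - b * c = a * d * (1 + z)) ∧
    (∃ w : ℚ_[p], ‖w‖ ≤ (p : ℝ) ^ (-(f : ℤ)) ∧
      (a * x + c * y) * (b * x + d * y) = a * d * x * y * (1 + w)) := by
  have hp : (1 : ℝ) ≤ p := mod_cast (Fact.out : p.Prime).one_le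
  have hp0 : (0 : ℝ) < p := by linarith
  have ha0 : a ≠ 0 := norm_ne_zero_iff.mp (by simp [ha])
  have hd0 : d ≠ 0 := norm_ne_zero_iff.mp (by simp [hd])
  have hy0 : y ≠ 0 := norm_ne_zero_iff.mp (by simp [hy])
  have hx0 : x ≠ 0 := norm_ne_zero_iff.mp (by rw [hx]; positivity)
  refine ⟨⟨-(b * c / (a * d)), ?_, by field_simp; ring⟩, ?_⟩
  · simpa [ha, hd] using (mul_le_of_le_one_left (norm_nonneg c) hb).trans hc
  have hu : ‖c * y / (a * x)‖ ≤ (p : ℝ) ^ (-(f : ℤ)) := by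
    rw [norm_div, norm_mul, norm_mul, ha, hy, mul_one, one_mul, hx, div_le_iff₀ (by positivity),
      ← zpow_add₀ hp0.ne']
    exact hc.trans (zpow_le_zpow_right₀ hp (by omega))
  have hv : ‖b * x / (d * y)‖ ≤ (p : ℝ) ^ (-(f : ℤ)) := by
    rw [norm_div, norm_mul, norm_mul, hd, hy, mul_one, div_one]
    refine (mul_le_of_le_one_left (norm_nonneg x) hb).trans ?_
    rw [hx]
    exact zpow_le_zpow_right₀ hp (by omega)
  have huv : ‖c * y / (a * x) * (b * x / (d * y))‖ ≤ (p : ℝ) ^ (-(f : ℤ)) := by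
    rw [norm_mul]
    refine (mul_le_of_le_one_right (norm_nonneg _) (hv.trans ?_)).trans hu
    exact zpow_le_one_of_nonpos₀ hp (by omega)
  refine ⟨c * y / (a * x) + b * x / (d * y) + c * y / (a * x) * (b * x / (d * y)), ?_, ?_⟩
  · exact (Padic.nonarchimedean _ _).trans
      (max_le ((Padic.nonarchimedean _ _).trans (max_le hu hv)) huv)
  · field_simp
    ring
end
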